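/- Let f : ℂ → ℙ¹ be a nonconstant meromorphic function. Then f has at most 4 totally ramified values, i.e., at most 4 values a ∈ ℙ¹ such that every solution of f(z) = a has multiplicity at least 2. In particular, a meromorphic function on ℂ with 5 or more totally ramified (multiple) values is constant. -/

import Mathlib

open Filter Topology

theorem IsLocalMax.second_deriv_nonpos {k k' : ℝ → ℝ} {x d : ℝ} (hmax : IsLocalMax k x)
    (hk : ∀ᶠ t in 𝓝 x, HasDerivAt k (k' t) t) (hk' : HasDerivAt k' d x) : d ≤ 0 := by
  by_contra! hd
  have h1 : deriv k =ᶠ[𝓝 x] k' := hk.mono fun t ht => ht.deriv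
  have h2 : deriv (deriv k) x = d := by rw [h1.deriv_eq, hk'.deriv]
  have hmin : IsLocalMin k x :=
    isLocalMin_of_deriv_deriv_pos (by rwa [h2]) hmax.deriv_eq_zero hk.self_of_nhds.continuousAt
  have h3 : k =ᶠ[𝓝 x] fun _ => k x := by
    filter_upwards [hmin, hmax] with t ht ht' using le_antisymm ht' ht
  have h4 : deriv k =ᶠ[𝓝 x] fun _ => (0 : ℝ) := by
    filter_upwards [h3.eventuallyEq_nhds] with t ht
    rw [ht.deriv_eq, deriv_const]
  have h5 : deriv (deriv k) x = 0 := by rw [h4.deriv_eq, deriv_const]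
  exact hd.ne' (h2.symm.trans h5)

theorem HasDerivAt.complex_re {p : ℝ → ℂ} {p' : ℂ} {t : ℝ} (hp : HasDerivAt p p' t) :
    HasDerivAt (fun t => (p t).re) p'.re t :=
  Complex.reCLM.hasFDerivAt.comp_hasDerivAt t hp

theorem HasDerivAt.complex_im {p : ℝ → ℂ} {p' : ℂ} {t : ℝ} (hp : HasDerivAt p p' t) :
    HasDerivAt (fun t => (p t).im) p'.im t :=
  Complex.imCLM.hasFDerivAt.comp_hasDerivAt t hp

theorem HasDerivAt.comp_line {ψ : ℂ → ℂ} {ψ' z e : ℂ} {t : ℝ}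
    (h : HasDerivAt ψ ψ' (z + t * e)) : HasDerivAt (fun t : ℝ => ψ (z + t * e)) (ψ' * e) t := by
  have hl : HasDerivAt (fun t : ℝ => z + t * e) e t := by
    simpa using ((Complex.ofRealCLM.hasDerivAt (x := t)).mul_const e).const_add z
  exact h.comp t hl

/-- First and second order conditions at a local maximum of `|ψ|² (R² - |z|²)²`
in the direction `e`. -/
theorem directional_conditions_of_isLocalMax {ι : Type*} [Fintype ι] {ψ : ι → ℂ → ℂ} {z₀ : ℂ} {R : ℝ}
    (hψ : ∀ i, AnalyticAt ℂ (ψ i) z₀)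
    (hmax : IsLocalMax
      (fun z => (∑ i, Complex.normSq (ψ i z)) * (R ^ 2 - Complex.normSq z) ^ 2) z₀)
    (e : ℂ) :
    let s := R ^ 2 - Complex.normSq z₀
    let x := z₀.re * e.re + z₀.im * e.im
    let A := ∑ i, Complex.normSq (ψ i z₀)
    let T := ∑ i, (starRingEnd ℂ (ψ i z₀) * (deriv (ψ i) z₀ * e)).re
    (2 * T * s ^ 2 - 4 * s * x * A = 0) ∧
    (2 * (∑ i, (Complex.normSq (deriv (ψ i) z₀ * e)
        + (starRingEnd ℂ (ψ i z₀) * (deriv (deriv (ψ i)) z₀ * e * e)).re)) * s ^ 2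
      - 16 * T * s * x + A * (8 * x ^ 2 - 4 * s * Complex.normSq e) ≤ 0) := by
  intro s x A T
  have hline : Tendsto (fun t : ℝ => z₀ + t * e) (𝓝 0) (𝓝 z₀) := by
    have : Continuous (fun t : ℝ => z₀ + t * e) := by fun_prop
    simpa using this.tendsto 0
  have hev : ∀ᶠ t : ℝ in 𝓝 (0:ℝ), ∀ i, AnalyticAt ℂ (ψ i) (z₀ + t * e) :=
    hline.eventually (eventually_all.2 fun i => (hψ i).eventually_analyticAt)
  set p : ι → ℝ → ℂ := fun i t => ψ i (z₀ + t * e) with hp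
  set p1 : ι → ℝ → ℂ := fun i t => deriv (ψ i) (z₀ + t * e) * e with hp1
  have dp : ∀ᶠ t in 𝓝 (0:ℝ), ∀ i, HasDerivAt (p i) (p1 i t) t := by
    filter_upwards [hev] with t ht i
    exact (ht i).differentiableAt.hasDerivAt.comp_line
  have dp1 : ∀ i, HasDerivAt (p1 i) (deriv (deriv (ψ i)) z₀ * e * e) 0 := fun i => by
    have h := (hψ i).deriv.differentiableAt.hasDerivAt
    have h0 : z₀ = z₀ + ((0:ℝ):ℂ) * e := by simp
    rw [h0] at h
    simpa using h.comp_line.mul_const e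
  set q : ℝ → ℝ := fun t => R ^ 2 - ((z₀.re + t * e.re) ^ 2 + (z₀.im + t * e.im) ^ 2) with hq
  set q1 : ℝ → ℝ := fun t =>
    -(2 * (z₀.re + t * e.re) * e.re + 2 * (z₀.im + t * e.im) * e.im) with hq1
  have dl : ∀ a b t : ℝ, HasDerivAt (fun t => a + t * b) b t := fun a b t => by
    simpa using ((hasDerivAt_id t).mul_const b).const_add a
  have dq : ∀ t, HasDerivAt q (q1 t) t := fun t => by
    have := (((dl z₀.re e.re t).pow 2).add ((dl z₀.im e.im t).pow 2)).const_sub (R ^ 2)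
    exact this.congr_deriv (by simp [hq1])
  have dq1 : ∀ t, HasDerivAt q1 (-(2 * Complex.normSq e)) t := fun t => by
    have := ((((dl z₀.re e.re t).const_mul 2).mul_const e.re).add
      (((dl z₀.im e.im t).const_mul 2).mul_const e.im)).neg
    exact this.congr_deriv (by simp [Complex.normSq_apply]; ring)
  set N : ℝ → ℝ := fun t => ∑ i, ((p i t).re ^ 2 + (p i t).im ^ 2) with hN
  set N1 : ℝ → ℝ := fun t =>
    ∑ i, (2 * ((p i t).re * (p1 i t).re) + 2 * ((p i t).im * (p1 i t).im)) with hN1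
  have dN : ∀ᶠ t in 𝓝 (0:ℝ), HasDerivAt N (N1 t) t := by
    filter_upwards [dp] with t ht
    refine HasDerivAt.fun_sum fun i _ => ?_
    exact (((ht i).complex_re.pow 2).add ((ht i).complex_im.pow 2)).congr_deriv (by simp; ring)
  have hdp0 := dp.self_of_nhds
  have dN1 : HasDerivAt N1 (∑ i, (2 * ((p1 i 0).re * (p1 i 0).re
      + (p i 0).re * (deriv (deriv (ψ i)) z₀ * e * e).re)
      + 2 * ((p1 i 0).im * (p1 i 0).im + (p i 0).im * (deriv (deriv (ψ i)) z₀ * e * e).im))) 0 :=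
    HasDerivAt.fun_sum fun i _ =>
      (((hdp0 i).complex_re.mul (dp1 i).complex_re).const_mul 2).add
        (((hdp0 i).complex_im.mul (dp1 i).complex_im).const_mul 2)
  have hmax' : IsLocalMax (fun t => N t * q t ^ 2) 0 := by
    have h0 : z₀ + ((0:ℝ):ℂ) * e = z₀ := by simp
    have := hline.eventually hmax
    filter_upwards [this] with t ht
    convert ht using 1 <;>
    simp [hN, hq, hp, Complex.normSq_apply, ← pow_two]
  have dk : ∀ᶠ t in 𝓝 (0:ℝ), HasDerivAt (fun t => N t * q t ^ 2)
      (N1 t * q t ^ 2 + N t * (2 * (q t * q1 t))) t := by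
    filter_upwards [dN] with t ht
    exact (ht.mul ((dq t).pow 2)).congr_deriv (by simp only [Pi.pow_apply]; push_cast; ring)
  have dk1 := (dN1.mul ((dq 0).pow 2)).add
    (dN.self_of_nhds.mul (((dq 0).mul (dq1 0)).const_mul 2))
  have c1 := hmax'.hasDerivAt_eq_zero dk.self_of_nhds
  have c2 := hmax'.second_deriv_nonpos dk dk1
  have q0 : q 0 = s := by simp [hq, s, Complex.normSq_apply]; ring
  have q10 : q1 0 = -2 * x := by simp [hq1, x]; ring
  have N0 : N 0 = A := by simp [hN, A, hp, Complex.normSq_apply, ← pow_two]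
  have N10 : N1 0 = 2 * T := by
    simp only [hN1, T, Finset.mul_sum, hp, hp1]
    refine Finset.sum_congr rfl fun i _ => ?_
    simp [Complex.mul_re]; ring
  have N20 : (∑ i, (2 * ((p1 i 0).re * (p1 i 0).re
      + (p i 0).re * (deriv (deriv (ψ i)) z₀ * e * e).re)
      + 2 * ((p1 i 0).im * (p1 i 0).im + (p i 0).im * (deriv (deriv (ψ i)) z₀ * e * e).im)))
      = 2 * ∑ i, (Complex.normSq (deriv (ψ i) z₀ * e)
        + (starRingEnd ℂ (ψ i z₀) * (deriv (deriv (ψ i)) z₀ * e * e)).re) := by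
    simp only [Finset.mul_sum, hp, hp1]
    refine Finset.sum_congr rfl fun i _ => ?_
    simp [Complex.mul_re, Complex.normSq_apply]; ring
  rw [N20] at c2
  simp only [q0, q10, N0, N10, Pi.pow_apply, Pi.mul_apply] at c1 c2
  constructor
  · linear_combination c1
  · refine le_of_eq_of_le ?_ c2
    push_cast
    ring

/-- At a local maximum of `|ψ|² (R² - |z|²)²` with `ψ` a holomorphic vector, the two-by-two
Wronskians of `ψ` are controlled by `|ψ|²`. -/
theorem wronskian_bound_of_isLocalMax {ι : Type*} [Fintype ι] {ψ : ι → ℂ → ℂ} {z₀ : ℂ} {R : ℝ}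
    (hψ : ∀ i, AnalyticAt ℂ (ψ i) z₀)
    (hmax : IsLocalMax
      (fun z => (∑ i, Complex.normSq (ψ i z)) * (R ^ 2 - Complex.normSq z) ^ 2) z₀)
    (hs : 0 < R ^ 2 - Complex.normSq z₀) {i j : ι} (hij : i ≠ j) :
    Complex.normSq (ψ i z₀ * deriv (ψ j) z₀ - ψ j z₀ * deriv (ψ i) z₀)
      * (R ^ 2 - Complex.normSq z₀) ^ 2
      ≤ 2 * R ^ 2 * (∑ i, Complex.normSq (ψ i z₀)) ^ 2 := by
  classical
  obtain ⟨f1, g1⟩ := directional_conditions_of_isLocalMax hψ hmax 1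
  obtain ⟨f2, g2⟩ := directional_conditions_of_isLocalMax hψ hmax Complex.I
  have hR : Complex.normSq z₀ = z₀.re ^ 2 + z₀.im ^ 2 := by rw [Complex.normSq_apply]; ring
  set s := R ^ 2 - Complex.normSq z₀ with hsdef
  set A := ∑ i, Complex.normSq (ψ i z₀) with hA
  set T1 := ∑ i, (starRingEnd ℂ (ψ i z₀) * (deriv (ψ i) z₀ * 1)).re with hT1
  set T2 := ∑ i, (starRingEnd ℂ (ψ i z₀) * (deriv (ψ i) z₀ * Complex.I)).re with hT2
  set B := ∑ i, Complex.normSq (deriv (ψ i) z₀) with hB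
  have hB2 : ∑ i, (Complex.normSq (deriv (ψ i) z₀ * 1)
        + (starRingEnd ℂ (ψ i z₀) * (deriv (deriv (ψ i)) z₀ * 1 * 1)).re)
      + ∑ i, (Complex.normSq (deriv (ψ i) z₀ * Complex.I)
        + (starRingEnd ℂ (ψ i z₀) * (deriv (deriv (ψ i)) z₀ * Complex.I * Complex.I)).re)
      = 2 * B := by
    rw [← Finset.sum_add_distrib, hB, Finset.mul_sum]
    refine Finset.sum_congr rfl fun i _ => ?_
    simp [Complex.normSq_apply]; ring
  simp only [Complex.one_re, Complex.one_im, Complex.I_re, Complex.I_im, Complex.normSq_one,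
    Complex.normSq_I, mul_one, mul_zero, add_zero, zero_add] at f1 f2 g1 g2 hB2
  simp only [mul_one] at hT1
  have e1 : T1 * s = 2 * z₀.re * A := by
    apply mul_left_cancel₀ (mul_ne_zero two_ne_zero hs.ne')
    linear_combination f1
  have e2 : T2 * s = 2 * z₀.im * A := by
    apply mul_left_cancel₀ (mul_ne_zero two_ne_zero hs.ne')
    linear_combination f2
  set β : ι → ℂ := fun i => s * deriv (ψ i) z₀ - 2 * starRingEnd ℂ z₀ * ψ i z₀ with hβ
  have hβsum : ∑ i, Complex.normSq (β i)
      = s ^ 2 * B - 4 * s * (z₀.re * T1 + z₀.im * T2) + 4 * Complex.normSq z₀ * A := by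
    rw [hB, hT1, hT2, hA]
    simp only [Finset.mul_sum, ← Finset.sum_add_distrib, ← Finset.sum_sub_distrib]
    refine Finset.sum_congr rfl fun i _ => ?_
    simp [hβ, Complex.normSq_apply]; ring
  have hβle : ∑ i, Complex.normSq (β i) ≤ 2 * R ^ 2 * A := by
    rw [hβsum]
    have hRs : R ^ 2 = s + Complex.normSq z₀ := by rw [hsdef]; ring
    have e3 : s * (z₀.re * T1 + z₀.im * T2) = 2 * Complex.normSq z₀ * A := by
      rw [hR]; linear_combination z₀.re * e1 + z₀.im * e2
    rw [hRs]
    nlinarith [g1, g2, hB2, e3, hR, congrArg (· * s ^ 2) hB2, congrArg (· * A) hR]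
  have hpair : ∀ F : ι → ℂ, Complex.normSq (F i) + Complex.normSq (F j)
      ≤ ∑ i, Complex.normSq (F i) := fun F => by
    rw [← Finset.sum_pair hij (f := fun i => Complex.normSq (F i))]
    exact Finset.sum_le_sum_of_subset_of_nonneg (Finset.subset_univ _)
      fun _ _ _ => Complex.normSq_nonneg _
  have hw : Complex.normSq (ψ i z₀ * deriv (ψ j) z₀ - ψ j z₀ * deriv (ψ i) z₀) * s ^ 2
      = Complex.normSq (ψ i z₀ * β j - ψ j z₀ * β i) := by
    rw [show ψ i z₀ * β j - ψ j z₀ * β i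
      = (ψ i z₀ * deriv (ψ j) z₀ - ψ j z₀ * deriv (ψ i) z₀) * (s : ℂ) by simp only [hβ]; ring]
    rw [Complex.normSq_mul, Complex.normSq_ofReal, pow_two]
  have hCS : ∀ a b c d : ℂ, Complex.normSq (a * d - b * c)
      ≤ (Complex.normSq a + Complex.normSq b) * (Complex.normSq c + Complex.normSq d) := by
    intro a b c d
    have : (Complex.normSq a + Complex.normSq b) * (Complex.normSq c + Complex.normSq d)
        - Complex.normSq (a * d - b * c)
        = Complex.normSq (starRingEnd ℂ a * c + starRingEnd ℂ b * d) := by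
      simp [Complex.normSq_apply]; ring
    linarith [Complex.normSq_nonneg (starRingEnd ℂ a * c + starRingEnd ℂ b * d)]
  have hA0 : 0 ≤ A := Finset.sum_nonneg fun _ _ => Complex.normSq_nonneg _
  calc _ = _ := hw
    _ ≤ _ := hCS _ _ _ _
    _ ≤ A * (2 * R ^ 2 * A) :=
      mul_le_mul (hpair fun i => ψ i z₀) ((hpair β).trans hβle)
        (add_nonneg (Complex.normSq_nonneg _) (Complex.normSq_nonneg _)) hA0
    _ = _ := by ring

theorem eq_of_eventually_mul_eq {X Y B : ℂ → ℂ} {z : ℂ} (hX : ContinuousAt X z)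
    (hY : ContinuousAt Y z) (hB : ∀ᶠ w in 𝓝[≠] z, B w ≠ 0)
    (h : ∀ᶠ w in 𝓝 z, X w * B w = Y w * B w) : X z = Y z := by
  refine tendsto_nhds_unique_of_eventuallyEq (l := 𝓝[≠] z) (hX.tendsto.mono_left nhdsWithin_le_nhds)
    (hY.tendsto.mono_left nhdsWithin_le_nhds) ?_
  filter_upwards [hB, h.filter_mono nhdsWithin_le_nhds] with w h1 h2 using mul_right_cancel₀ h1 h2

/-- Local divisibility of an entire function by another one gives an entire quotient. -/
theorem exists_entire_quotient {A B : ℂ → ℂ} (hB : ∀ z, ∀ᶠ w in 𝓝[≠] z, B w ≠ 0)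
    (h : ∀ z, ∃ q, AnalyticAt ℂ q z ∧ ∀ᶠ w in 𝓝 z, A w = q w * B w) :
    ∃ Q : ℂ → ℂ, (∀ z, AnalyticAt ℂ Q z) ∧ ∀ z, A z = Q z * B z := by
  choose q hq hqA using h
  refine ⟨fun z => q z z, fun z => ?_, fun z => (hqA z).self_of_nhds⟩
  refine (hq z).congr ?_
  filter_upwards [(hq z).eventually_analyticAt, (hqA z).eventually_nhds] with y hy hyA
  refine eq_of_eventually_mul_eq hy.continuousAt (hq y).continuousAt (hB y) ?_
  filter_upwards [hyA, hqA y] with w h1 h2 using h1.symm.trans h2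

theorem AnalyticAt.exists_sq_eq {f : ℂ → ℂ} {z : ℂ} (hf : AnalyticAt ℂ f z) (hz : f z ≠ 0) :
    ∃ φ, AnalyticAt ℂ φ z ∧ ∀ᶠ w in 𝓝 z, φ w ^ 2 = f w := by
  obtain ⟨c, hc⟩ := IsAlgClosed.exists_pow_nat_eq (f z) (n := 2) two_pos
  have h1 : f z / f z ∈ Complex.slitPlane := by simp [div_self hz]
  refine ⟨fun w => c * Complex.exp (Complex.log (f w / f z) / 2), ?_, ?_⟩
  · have : AnalyticAt ℂ (fun w => Complex.log (f w / f z)) z :=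
      AnalyticAt.clog (hf.div analyticAt_const hz) h1
    exact analyticAt_const.mul ((this.div analyticAt_const two_ne_zero).cexp)
  · filter_upwards [hf.continuousAt.eventually_ne hz] with w hw
    rw [mul_pow, hc, ← Complex.exp_nat_mul]
    rw [show ((2 : ℕ) : ℂ) * (Complex.log (f w / f z) / 2) = Complex.log (f w / f z) by
      push_cast; ring, Complex.exp_log (div_ne_zero hw hz)]
    field_simp

/-- An analytic function vanishing to order at least two divides the square of its derivative. -/
theorem AnalyticAt.exists_deriv_sq_eq_mul {f : ℂ → ℂ} {z : ℂ} (hf : AnalyticAt ℂ f z)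
    (hne : ∀ᶠ w in 𝓝[≠] z, f w ≠ 0) (h0 : f z = 0) (h1 : deriv f z = 0) :
    ∃ r, AnalyticAt ℂ r z ∧ ∀ᶠ w in 𝓝 z, deriv f w ^ 2 = r w * f w := by
  have hnz : ¬ ∀ᶠ w in 𝓝 z, f w = 0 := fun h =>
    ((hne.and (h.filter_mono nhdsWithin_le_nhds)).exists).elim fun w hw => hw.1 hw.2
  obtain ⟨n, u, hu, huz, hfu⟩ := hf.exists_eventuallyEq_pow_smul_nonzero_iff.2 hnz
  simp only [smul_eq_mul] at hfu
  have hd : ∀ᶠ w in 𝓝 z,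
      deriv f w = n * (w - z) ^ (n - 1) * u w + (w - z) ^ n * deriv u w := by
    filter_upwards [EventuallyEq.eventuallyEq_nhds hfu, hu.eventually_analyticAt] with w hw hua
    rw [hw.deriv_eq]
    have := (((hasDerivAt_id w).sub_const z).pow n).mul hua.differentiableAt.hasDerivAt
    exact (this.congr_deriv (by simp)).deriv
  obtain _ | _ | m := n
  · exact absurd (by simpa [h0] using hfu.self_of_nhds.symm) huz
  · have := hd.self_of_nhds
    simp [h1] at this
    exact absurd this.symm huz
  · refine ⟨fun w => (w - z) ^ m * ((m + 2) * u w + (w - z) * deriv u w) ^ 2 / u w, ?_, ?_⟩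
    · have := hu.deriv
      exact AnalyticAt.div (by fun_prop) hu huz
    · filter_upwards [hd, hfu, hu.continuousAt.eventually_ne huz] with w h1 h2 h3
      rw [h1, h2]
      field_simp
      push_cast
      ring

/-- An Ahlfors-Schwarz type lemma: a nonnegative function that is locally the squared length of
a holomorphic vector, with a Wronskian bounded below in terms of it, vanishes. -/
theorem eq_zero_of_wronskian_lower_bound {ι : Type*} [Fintype ι] {u : ℂ → ℝ} {c : ℝ}
    (hu : Continuous u) (hu0 : ∀ z, 0 ≤ u z) (hc : 0 < c)
    (h : ∀ z₀, 0 < u z₀ → ∃ ψ : ι → ℂ → ℂ, (∀ i, AnalyticAt ℂ (ψ i) z₀) ∧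
      (∀ᶠ z in 𝓝 z₀, u z = ∑ i, Complex.normSq (ψ i z)) ∧
      ∃ i j, i ≠ j ∧
        c * u z₀ ^ 3 ≤ Complex.normSq (ψ i z₀ * deriv (ψ j) z₀ - ψ j z₀ * deriv (ψ i) z₀))
    (z : ℂ) : u z = 0 := by
  have key : ∀ R : ℝ, 0 < R → Complex.normSq z < R ^ 2 →
      c * (u z * (R ^ 2 - Complex.normSq z) ^ 2) ≤ 2 * R ^ 2 := by
    intro R hR hzR
    set v : ℂ → ℝ := fun z => u z * (R ^ 2 - Complex.normSq z) ^ 2 with hv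
    have hvc : Continuous v := hu.mul ((continuous_const.sub Complex.continuous_normSq).pow 2)
    have hmem : ∀ w : ℂ, w ∈ Metric.closedBall (0 : ℂ) R ↔ Complex.normSq w ≤ R ^ 2 := fun w => by
      rw [mem_closedBall_zero_iff, Complex.normSq_eq_norm_sq,
        pow_le_pow_iff_left₀ (norm_nonneg _) hR.le two_ne_zero]
    obtain ⟨z₀, hz₀, hmax⟩ := (isCompact_closedBall (0 : ℂ) R).exists_isMaxOn
      ⟨z, (hmem z).2 hzR.le⟩ hvc.continuousOn
    have hle : v z ≤ v z₀ := hmax ((hmem z).2 hzR.le)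
    change c * v z ≤ _
    rcases le_or_gt (v z₀) 0 with hv0 | hv0
    · nlinarith [sq_nonneg R]
    have hs : 0 < R ^ 2 - Complex.normSq z₀ := by
      rcases ((hmem z₀).1 hz₀).lt_or_eq with hlt | heq
      · linarith
      · simp [hv, heq] at hv0
    have hu1 : 0 < u z₀ := (hu0 z₀).lt_of_ne fun he => by simp [hv, ← he] at hv0
    obtain ⟨ψ, hψ, huψ, i, j, hij, hw⟩ := h z₀ hu1
    have hnhds : Metric.closedBall (0 : ℂ) R ∈ 𝓝 z₀ := by
      filter_upwards [Complex.continuous_normSq.continuousAt.eventually_lt continuousAt_const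
        (sub_pos.1 hs)] with w hw using (hmem w).2 hw.le
    have hloc : IsLocalMax
        (fun z => (∑ i, Complex.normSq (ψ i z)) * (R ^ 2 - Complex.normSq z) ^ 2) z₀ := by
      filter_upwards [hmax.isLocalMax hnhds, huψ] with w h1 h2
      simpa only [hv, h2, huψ.self_of_nhds] using h1
    have hb := wronskian_bound_of_isLocalMax hψ hloc hs hij
    rw [← huψ.self_of_nhds] at hb
    have h3 : c * u z₀ ^ 3 * (R ^ 2 - Complex.normSq z₀) ^ 2 ≤ 2 * R ^ 2 * u z₀ ^ 2 :=
      (mul_le_mul_of_nonneg_right hw (sq_nonneg _)).trans hb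
    have h4 : c * v z₀ ≤ 2 * R ^ 2 := by
      refine le_of_mul_le_mul_right ?_ (pow_pos hu1 2)
      calc _ = c * u z₀ ^ 3 * (R ^ 2 - Complex.normSq z₀) ^ 2 := by simp only [hv]; ring
        _ ≤ _ := h3
    exact (mul_le_mul_of_nonneg_left hle hc.le).trans h4
  by_contra hne
  have hpos : 0 < u z := (hu0 z).lt_of_ne' hne
  have ha := Complex.normSq_nonneg z
  set a := Complex.normSq z
  have hcu : 0 < c * u z := mul_pos hc hpos
  set t := a + 4 / (c * u z) + 1 with ht
  have h4 : 0 < 4 / (c * u z) := by positivity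
  have ht0 : 0 < a + t := by positivity
  have hk := key (Real.sqrt (a + t)) (Real.sqrt_pos.2 ht0)
  rw [Real.sq_sqrt ht0.le] at hk
  have hk' := hk (by linarith)
  have h5 : c * u z * t = c * u z * (a + 1) + 4 := by rw [ht]; field_simp; ring
  have h6 : c * u z * t * t ≤ 4 * t := by nlinarith
  have h7 : c * u z * t ≤ 4 := le_of_mul_le_mul_right h6 (by linarith)
  nlinarith

/-- Among linear forms in two variables in general position, at every point all but one are
comparable to the sum. -/
theorem exists_uniform_lower_bound {ι : Type*} [Fintype ι] [Nontrivial ι] (c : ι → ι → ℂ)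
    (hc : ∀ i j, i ≠ j → c i j ≠ 0) :
    ∃ δ > 0, (∀ i j, i ≠ j → δ ≤ ‖c i j‖) ∧ ∀ l : ι → ℂ,
      (∀ i j k, c i j * l k + c j k * l i + c k i * l j = 0) →
      ∃ i, ∀ k, k ≠ i → δ * ∑ j, ‖l j‖ ≤ ‖l k‖ := by
  obtain ⟨i₀, j₀, hij₀⟩ := exists_pair_ne ι
  obtain ⟨m, hm, hmc⟩ : ∃ m > 0, ∀ i j, i ≠ j → m ≤ ‖c i j‖ := by
    have : Nonempty {p : ι × ι // p.1 ≠ p.2} := ⟨⟨(i₀, j₀), hij₀⟩⟩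
    obtain ⟨p, hp⟩ := Finite.exists_min
      (fun p : {p : ι × ι // p.1 ≠ p.2} => ‖c p.1.1 p.1.2‖)
    exact ⟨_, norm_pos_iff.2 (hc _ _ p.2), fun i j hij => hp ⟨(i, j), hij⟩⟩
  obtain ⟨M, hM⟩ : ∃ M, ∀ i j, ‖c i j‖ ≤ M := by
    obtain ⟨p, hp⟩ := Finite.exists_max
      (fun p : ι × ι => ‖c p.1 p.2‖)
    exact ⟨_, fun i j => hp (i, j)⟩
  have hM0 : 0 < M := hm.trans_le ((hmc i₀ j₀ hij₀).trans (hM i₀ j₀))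
  have hN : (0 : ℝ) < 2 * Fintype.card ι * M := by
    have : 0 < Fintype.card ι := Fintype.card_pos
    positivity
  refine ⟨min m (m / (2 * Fintype.card ι * M)), lt_min hm (div_pos hm hN),
    fun i j hij => (min_le_left _ _).trans (hmc i j hij), fun l hl => ?_⟩
  obtain ⟨i, hi⟩ := Finite.exists_min (fun i => ‖l i‖)
  refine ⟨i, fun k hk => ?_⟩
  have hj : ∀ j, m * ‖l j‖ ≤ 2 * M * ‖l k‖ := fun j => by
    have h1 : c i k * l j = -(c k j * l i + c j i * l k) := by linear_combination hl i k j
    calc m * ‖l j‖ ≤ ‖c i k‖ * ‖l j‖ :=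
          mul_le_mul_of_nonneg_right (hmc i k hk.symm) (norm_nonneg _)
      _ = ‖c k j * l i + c j i * l k‖ := by rw [← norm_mul, h1, norm_neg]
      _ ≤ ‖c k j‖ * ‖l i‖ + ‖c j i‖ * ‖l k‖ := by
          rw [← norm_mul, ← norm_mul]; exact norm_add_le _ _
      _ ≤ M * ‖l k‖ + M * ‖l k‖ := by
          gcongr
          exacts [hM _ _, hi k, hM _ _]
      _ = _ := by ring
  have hsum : m * ∑ j, ‖l j‖ ≤ 2 * Fintype.card ι * M * ‖l k‖ := by
    rw [Finset.mul_sum]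
    refine (Finset.sum_le_sum fun j _ => hj j).trans_eq ?_
    simp; ring
  calc _ ≤ m / (2 * Fintype.card ι * M) * ∑ j, ‖l j‖ :=
        mul_le_mul_of_nonneg_right (min_le_right _ _) (Finset.sum_nonneg fun _ _ => norm_nonneg _)
    _ = (m * ∑ j, ‖l j‖) / (2 * Fintype.card ι * M) := by ring
    _ ≤ ‖l k‖ := by rw [div_le_iff₀ hN]; linarith

/-- Two entire functions with vanishing Wronskian are linearly dependent. -/
theorem eq_const_mul_of_wronskian_eq_zero {F G : ℂ → ℂ} (hF : Differentiable ℂ F)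
    (hG : Differentiable ℂ G) (h : ∀ z, F z * deriv G z - deriv F z * G z = 0)
    {z₀ : ℂ} (hz₀ : F z₀ ≠ 0) : ∃ κ, ∀ z, G z = κ * F z := by
  obtain ⟨r, hr, hball⟩ := Metric.eventually_nhds_iff_ball.1
    (hF.continuous.continuousAt.eventually_ne hz₀)
  have hd : ∀ z ∈ Metric.ball z₀ r, HasDerivAt (fun z => G z / F z) 0 z := fun z hz => by
    refine ((hG z).hasDerivAt.div (hF z).hasDerivAt (hball z hz)).congr_deriv ?_
    rw [show deriv G z * F z - G z * deriv F z = 0 by linear_combination h z, zero_div]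
  have hconst : ∀ z ∈ Metric.ball z₀ r, G z / F z = G z₀ / F z₀ := fun z hz =>
    Metric.isOpen_ball.is_const_of_deriv_eq_zero (convex_ball z₀ r).isPreconnected
      (fun z hz => (hd z hz).differentiableAt.differentiableWithinAt)
      (fun z hz => (hd z hz).deriv) hz (Metric.mem_ball_self hr)
  refine ⟨G z₀ / F z₀, fun z => ?_⟩
  have hκF : Differentiable ℂ (fun z => G z₀ / F z₀ * F z) := hF.const_mul _
  refine congrFun (AnalyticOnNhd.eq_of_eventuallyEq (z₀ := z₀) (fun z _ => hG.analyticAt z)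
    (fun z _ => hκF.analyticAt z) ?_) z
  filter_upwards [Metric.ball_mem_nhds z₀ hr] with z hz
  rw [← hconst z hz, div_mul_cancel₀ _ (hball z hz)]

/-- Nevanlinna's theorem on totally ramified values: a nonconstant meromorphic function
`φ : ℂ → ℙ¹` has at most 4 totally ramified values. Here `φ` is represented by a pair of
entire functions `(g, h)` without common zeros (so `φ = (g : h)` in homogeneous
coordinates), values `a = (a₁ : a₂) ∈ ℙ¹` by nonzero pairs, and `a` is totally ramified
if every zero of `a₂·g − a₁·h` has multiplicity `≥ 2`. There cannot be 5 pairwise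
distinct totally ramified values. -/
theorem at_most_four_totally_ramified_values
    (g h : ℂ → ℂ) (hg : Differentiable ℂ g) (hh : Differentiable ℂ h)
    (hnz : ∀ z : ℂ, g z ≠ 0 ∨ h z ≠ 0)
    (hnonconst : ¬ ∃ a b : ℂ, (a, b) ≠ (0, 0) ∧ ∀ z : ℂ, a * g z + b * h z = 0)
    (v : Fin 5 → ℂ × ℂ) (hv : ∀ i, v i ≠ (0, 0))
    (hdistinct : ∀ i j, i ≠ j → (v i).1 * (v j).2 ≠ (v i).2 * (v j).1)
    (hram : ∀ i, ∀ z : ℂ, (v i).2 * g z - (v i).1 * h z = 0 →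
      (v i).2 * deriv g z - (v i).1 * deriv h z = 0) :
    False := by
  set c : Fin 5 → Fin 5 → ℂ := fun i j => (v i).1 * (v j).2 - (v i).2 * (v j).1 with hc
  have hc0 : ∀ i j, i ≠ j → c i j ≠ 0 := fun i j hij => sub_ne_zero.2 (hdistinct i j hij)
  set L : Fin 5 → ℂ → ℂ := fun i z => (v i).2 * g z - (v i).1 * h z with hL
  set W : ℂ → ℂ := fun z => g z * deriv h z - deriv g z * h z with hW
  have hLd : ∀ i, Differentiable ℂ (L i) := fun i => (hg.const_mul _).sub (hh.const_mul _)
  have hLa : ∀ i z, AnalyticAt ℂ (L i) z := fun i z => (hLd i).analyticAt z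
  have hWa : ∀ z, AnalyticAt ℂ W z := fun z =>
    ((hg.analyticAt z).mul (hh.analyticAt z).deriv).sub
      ((hg.analyticAt z).deriv.mul (hh.analyticAt z))
  have hLderiv : ∀ i z, deriv (L i) z = (v i).2 * deriv g z - (v i).1 * deriv h z := fun i z =>
    (((hg z).hasDerivAt.const_mul _).sub ((hh z).hasDerivAt.const_mul _)).deriv
  have hram' : ∀ i z, L i z = 0 → deriv (L i) z = 0 := fun i z hz => by
    rw [hLderiv]; exact hram i z hz
  have hwron : ∀ i j z, L i z * deriv (L j) z - deriv (L i) z * L j z = c i j * W z := by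
    intro i j z
    rw [hLderiv, hLderiv]
    simp only [hL, hW, hc]; ring
  have hLne : ∀ i z, ∀ᶠ w in 𝓝[≠] z, L i w ≠ 0 := by
    intro i z
    refine (hLa i z).eventually_eq_zero_or_eventually_ne_zero.resolve_left fun hz => ?_
    have h0 : L i = fun _ => 0 := AnalyticOnNhd.eq_of_eventuallyEq (z₀ := z)
      (fun z _ => hLa i z) (fun z _ => analyticAt_const) hz
    refine hnonconst ⟨(v i).2, -(v i).1, fun he => hv i ?_, fun w => ?_⟩
    · simp only [Prod.mk.injEq, neg_eq_zero] at he
      exact Prod.ext he.2 he.1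
    · linear_combination congrFun h0 w
  have hLpair : ∀ i j z, i ≠ j → L i z = 0 → L j z ≠ 0 := by
    intro i j z hij hi hj
    simp only [hL] at hi hj
    rcases hnz z with hz | hz <;> apply mul_ne_zero (hc0 i j hij) hz <;> simp only [hc]
    · linear_combination (v i).1 * hj - (v j).1 * hi
    · linear_combination (v i).2 * hj - (v j).2 * hi
  obtain ⟨Q, hQa, hQ⟩ : ∃ Q : ℂ → ℂ, (∀ z, AnalyticAt ℂ Q z) ∧
      ∀ z, W z ^ 2 = Q z * ∏ i, L i z := by
    refine exists_entire_quotient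
      (fun z => by simpa only [Finset.prod_ne_zero_iff, Finset.mem_univ, true_imp_iff]
        using eventually_all.2 fun i => hLne i z) fun z => ?_
    by_cases hz : ∃ k, L k z = 0
    · obtain ⟨k, hk⟩ := hz
      obtain ⟨j, hjk⟩ := exists_ne k
      obtain ⟨r, hr, hrL⟩ :=
        (hLa k z).exists_deriv_sq_eq_mul (hLne k z) hk (hram' k z hk)
      have hP : ∏ i ∈ Finset.univ.erase k, L i z ≠ 0 :=
        Finset.prod_ne_zero_iff.2 fun i hi => hLpair k i z (Finset.ne_of_mem_erase hi).symm hk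
      have hPa : AnalyticAt ℂ (fun w => ∏ i ∈ Finset.univ.erase k, L i w) z :=
        Finset.analyticAt_fun_prod _ fun i _ => hLa i z
      refine ⟨fun w => (L k w * deriv (L j) w ^ 2 - 2 * deriv (L j) w * deriv (L k) w * L j w
        + r w * L j w ^ 2) / c k j ^ 2 / ∏ i ∈ Finset.univ.erase k, L i w, ?_, ?_⟩
      · have h1 := hLa k z
        have h2 := (hLa k z).deriv
        have h3 := hLa j z
        have h4 := (hLa j z).deriv
        refine AnalyticAt.div (AnalyticAt.div ?_ analyticAt_const
          (pow_ne_zero 2 (hc0 k j hjk.symm))) hPa hP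
        fun_prop
      · filter_upwards [hrL, hPa.continuousAt.eventually_ne hP] with w h1 h2
        rw [← Finset.mul_prod_erase _ _ (Finset.mem_univ k), eq_comm]
        have hck := hc0 k j hjk.symm
        field_simp
        linear_combination -(L j w ^ 2) * h1
          + (L k w * deriv (L j) w - deriv (L k) w * L j w + c k j * W w) * hwron k j w
    · push Not at hz
      have hP : ∏ i, L i z ≠ 0 := Finset.prod_ne_zero_iff.2 fun i _ => hz i
      have hPa : AnalyticAt ℂ (fun w => ∏ i, L i w) z :=
        Finset.analyticAt_fun_prod _ fun i _ => hLa i z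
      refine ⟨fun w => W w ^ 2 / ∏ i, L i w, ((hWa z).pow 2).div hPa hP, ?_⟩
      filter_upwards [hPa.continuousAt.eventually_ne hP] with w hw
      rw [div_mul_cancel₀ _ hw]
  obtain ⟨δ, hδ, hδc, hδL⟩ := exists_uniform_lower_bound c hc0
  have hvanish := eq_zero_of_wronskian_lower_bound (ι := Fin 5)
    (u := fun z => ∑ i, ‖Q z * L i z‖) (c := δ ^ 5 / 4)
    (continuous_finsetSum _ fun i _ =>
      ((Differentiable.continuous fun z => (hQa z).differentiableAt).mul (hLd i).continuous).norm)
    (fun z => Finset.sum_nonneg fun _ _ => norm_nonneg _) (by positivity) ?_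
  · have hW0 : ∀ z, W z = 0 := by
      intro z
      have hall := (Finset.sum_eq_zero_iff_of_nonneg fun _ _ => norm_nonneg _).1 (hvanish z)
      have hQ0 : Q z = 0 := by
        by_contra hQz
        have hL0 : ∀ i, L i z = 0 := fun i => by simpa [hQz] using hall i (Finset.mem_univ i)
        exact hLpair 0 1 z (by decide) (hL0 0) (hL0 1)
      simpa [hQ0] using hQ z
    obtain ⟨z₀, hz₀⟩ := (hLne 0 0).exists
    obtain ⟨κ, hκ⟩ := eq_const_mul_of_wronskian_eq_zero (hLd 0) (hLd 1)
      (fun z => by rw [hwron, hW0, mul_zero]) hz₀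
    refine hnonconst ⟨(v 1).2 - κ * (v 0).2, -((v 1).1 - κ * (v 0).1), fun he => ?_, fun w => ?_⟩
    · simp only [Prod.mk.injEq, neg_eq_zero] at he
      apply hc0 0 1 (by decide)
      simp only [hc]
      linear_combination (v 0).1 * he.1 - (v 0).2 * he.2
    · linear_combination hκ w
  · intro z hz
    have hQz : Q z ≠ 0 := by
      rintro h0
      simp [h0] at hz
    have hsqrt : ∀ i, ∃ ψ, AnalyticAt ℂ ψ z ∧ ∀ᶠ w in 𝓝 z, ψ w ^ 2 = Q w * L i w := by
      intro i
      by_cases hi : L i z = 0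
      · have hP : ∏ j ∈ Finset.univ.erase i, L j z ≠ 0 :=
          Finset.prod_ne_zero_iff.2 fun j hj => hLpair i j z (Finset.ne_of_mem_erase hj).symm hi
        obtain ⟨φ, hφ, hφP⟩ := AnalyticAt.exists_sq_eq
          (Finset.analyticAt_fun_prod (Finset.univ.erase i) fun j _ => hLa j z) hP
        have hφz : φ z ≠ 0 := fun h0 => hP (by simpa [h0] using hφP.self_of_nhds.symm)
        refine ⟨fun w => W w / φ w, (hWa z).div hφ hφz, ?_⟩
        filter_upwards [hφP, hφ.continuousAt.eventually_ne hφz] with w h1 h2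
        rw [div_pow, div_eq_iff (pow_ne_zero 2 h2), hQ, h1,
          ← Finset.mul_prod_erase _ _ (Finset.mem_univ i), mul_assoc]
      · exact AnalyticAt.exists_sq_eq ((hQa z).mul (hLa i z)) (mul_ne_zero hQz hi)
    choose ψ hψ hψsq using hsqrt
    refine ⟨ψ, hψ, ?_, ?_⟩
    · filter_upwards [eventually_all.2 hψsq] with w hw
      refine Finset.sum_congr rfl fun i _ => ?_
      rw [← hw i, norm_pow, Complex.normSq_eq_norm_sq]
    · obtain ⟨i, hi⟩ := hδL (fun k => L k z) fun i j k => by simp only [hc, hL]; ring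
      obtain ⟨j, hji⟩ := exists_ne i
      refine ⟨i, j, hji.symm, ?_⟩
      have hwψ : 4 * (ψ i z * deriv (ψ j) z - ψ j z * deriv (ψ i) z) ^ 2
          = c i j ^ 2 * Q z ^ 3 * ∏ k ∈ (Finset.univ.erase i).erase j, L k z := by
        refine eq_of_eventually_mul_eq (B := fun w => Q w ^ 2 * L i w * L j w)
          (X := fun w => 4 * (ψ i w * deriv (ψ j) w - ψ j w * deriv (ψ i) w) ^ 2)
          (Y := fun w => c i j ^ 2 * Q w ^ 3 * ∏ k ∈ (Finset.univ.erase i).erase j, L k w)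
          ?_ ?_ ?_ ?_
        · have h1 := hψ i
          have h2 := hψ j
          have h3 := (hψ i).deriv
          have h4 := (hψ j).deriv
          exact AnalyticAt.continuousAt (𝕜 := ℂ) (by fun_prop)
        · have h1 : AnalyticAt ℂ (fun w => ∏ k ∈ (Finset.univ.erase i).erase j, L k w) z :=
            Finset.analyticAt_fun_prod _ fun i _ => hLa i z
          have h2 := hQa z
          exact ((analyticAt_const.mul (h2.pow 3)).mul h1).continuousAt
        · filter_upwards [hLne i z, hLne j z,
            ((hQa z).continuousAt.eventually_ne hQz).filter_mono nhdsWithin_le_nhds]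
            with w h1 h2 h3
          exact mul_ne_zero (mul_ne_zero (pow_ne_zero 2 h3) h1) h2
        · have hder : ∀ k, ∀ᶠ w in 𝓝 z,
              2 * ψ k w * deriv (ψ k) w = deriv Q w * L k w + Q w * deriv (L k) w := fun k => by
            filter_upwards [EventuallyEq.eventuallyEq_nhds (hψsq k), (hψ k).eventually_analyticAt]
              with w h1 h2
            have h3 := (h2.differentiableAt.hasDerivAt.pow 2).deriv
            have h4 := ((hQa w).differentiableAt.hasDerivAt.mul (hLd k w).hasDerivAt).deriv
            have h5 := h1.deriv_eq
            have h6 : deriv (fun w => ψ k w ^ 2) w = 2 * ψ k w * deriv (ψ k) w :=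
              h3.trans (by norm_num)
            rw [← h6, h5]
            exact h4
          filter_upwards [hder i, hder j, hψsq i, hψsq j] with w di dj si sj
          have hprod : ∏ k, L k w
              = L i w * (L j w * ∏ k ∈ (Finset.univ.erase i).erase j, L k w) := by
            rw [Finset.mul_prod_erase _ (fun k => L k w) (Finset.mem_erase.2 ⟨hji, Finset.mem_univ j⟩),
              Finset.mul_prod_erase _ (fun k => L k w) (Finset.mem_univ i)]
          have hw2 := hQ w
          rw [hprod] at hw2
          have hD : 2 * (ψ i w * ψ j w) * (ψ i w * deriv (ψ j) w - ψ j w * deriv (ψ i) w)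
              = Q w ^ 2 * c i j * W w := by
            linear_combination ψ i w ^ 2 * dj - ψ j w ^ 2 * di
              + (deriv Q w * L j w + Q w * deriv (L j) w) * si
              - (deriv Q w * L i w + Q w * deriv (L i) w) * sj + Q w ^ 2 * hwron i j w
          calc _ = (2 * (ψ i w * ψ j w)
                * (ψ i w * deriv (ψ j) w - ψ j w * deriv (ψ i) w)) ^ 2 := by
                rw [mul_pow, mul_pow, mul_pow, si, sj]; ring
            _ = Q w ^ 4 * c i j ^ 2 * W w ^ 2 := by rw [hD]; ring
            _ = _ := by rw [hw2]; ring
      have hnorm := congrArg norm hwψ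
      simp only [norm_mul, norm_pow, norm_prod, Complex.norm_ofNat] at hnorm
      set S := ∑ k, ‖L k z‖ with hS
      have hS0 : 0 ≤ S := Finset.sum_nonneg fun _ _ => norm_nonneg _
      have hprod : (δ * S) ^ 3 ≤ ∏ k ∈ (Finset.univ.erase i).erase j, ‖L k z‖ := by
        have hcard : ((Finset.univ.erase i).erase j).card = 3 := by
          rw [Finset.card_erase_of_mem (Finset.mem_erase.2 ⟨hji, Finset.mem_univ j⟩),
            Finset.card_erase_of_mem (Finset.mem_univ i)]
          rfl
        rw [← hcard, ← Finset.prod_const]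
        exact Finset.prod_le_prod (fun _ _ => by positivity) fun k hk =>
          hi k (Finset.ne_of_mem_erase (Finset.mem_of_mem_erase hk))
      have husum : ∑ k, ‖Q z * L k z‖ = ‖Q z‖ * S := by
        rw [hS, Finset.mul_sum]; simp only [norm_mul]
      rw [Complex.normSq_eq_norm_sq, husum]
      have hlow : δ ^ 2 * ‖Q z‖ ^ 3 * (δ * S) ^ 3 ≤ ‖c i j‖ ^ 2 * ‖Q z‖ ^ 3
          * ∏ k ∈ (Finset.univ.erase i).erase j, ‖L k z‖ := by
        gcongr
        exact hδc i j hji.symm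
      rw [← hnorm] at hlow
      linarith [show δ ^ 2 * ‖Q z‖ ^ 3 * (δ * S) ^ 3 = δ ^ 5 * (‖Q z‖ * S) ^ 3 by ring]
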